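/- arXiv:2305.10702 — 4 statements merged into one kernel-verified Lean document; each statement's English description precedes it below -/
import Mathlib

section
/- Define the quadratic form q : ZZ^4 -> ZZ by q(r,m,n,s) = 4m^2 + 2mn - 2n^2 - 2rs, and the linear map phi : ZZ^4 -> ZZ^2 by phi(r,m,n,s) = (4m + n + 2s, -r - 4m - n - s). Then for every pair of integers (a,b) there exists w in ZZ^4 such that phi(w) = (a,b) and q(w) >= -2. -/
/-- The Mukai square on the rank-4 sublattice of the Mukai lattice of a quartic
K3 surface containing a line: `q(r,m,n,s) = 4m² + 2mn - 2n² - 2rs`. -/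
def quarticQ (w : ℤ × ℤ × ℤ × ℤ) : ℤ :=
  4 * w.2.1 ^ 2 + 2 * w.2.1 * w.2.2.1 - 2 * w.2.2.1 ^ 2 - 2 * w.1 * w.2.2.2

/-- The induced map `Φ_* : ℤ⁴ → ℤ²`,
`φ(r,m,n,s) = (4m + n + 2s, -r - 4m - n - s)`. -/
def quarticPhi (w : ℤ × ℤ × ℤ × ℤ) : ℤ × ℤ :=
  (4 * w.2.1 + w.2.2.1 + 2 * w.2.2.2, -w.1 - 4 * w.2.1 - w.2.2.1 - w.2.2.2)

/-- For every pair of integers `(a,b)` there exists `w ∈ ℤ⁴` with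
`φ(w) = (a,b)` and `q(w) ≥ -2`. -/
theorem quartic_lift_exists (a b : ℤ) :
    ∃ w : ℤ × ℤ × ℤ × ℤ, quarticPhi w = (a, b) ∧ quarticQ w ≥ -2 := by
  have key : ∀ x : ℤ, 0 ≤ x * (x + 1) := by
    intro x
    rcases le_or_gt 0 x with h | h
    · positivity
    · nlinarith
  obtain ⟨k, hk⟩ := Int.even_or_odd' a
  obtain ⟨j, hj⟩ := Int.even_or_odd' b
  -- choose `m, s`, then `n = a - 4m - 2s` and `r = s - a - b`
  have main : ∀ m s : ℤ,
      -36 * m ^ 2 - 36 * m * s - 10 * s ^ 2 + 18 * m * a + s * (10 * a + 2 * b) - 2 * a ^ 2 ≥ -2 →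
      ∃ w : ℤ × ℤ × ℤ × ℤ, quarticPhi w = (a, b) ∧ quarticQ w ≥ -2 := by
    intro m s h
    refine ⟨(s - a - b, m, a - 4 * m - 2 * s, s), ?_, ?_⟩
    · simp only [quarticPhi, Prod.mk.injEq]
      constructor <;> ring
    · simp only [quarticQ]
      linarith
  rcases hj with hj | hj
  · apply main (-j) (k + b)
    rcases hk with hk | hk <;> subst hk <;> subst hj <;>
      nlinarith [key k, key (k + 2 * j), sq_nonneg k, sq_nonneg (k + 2 * j)]
  · apply main (-j - 1) (k + b + 1)
    rcases hk with hk | hk <;> subst hk <;> subst hj <;>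
      nlinarith [key k, key (k + 2 * j + 1), sq_nonneg k, sq_nonneg (k + 2 * j + 1)]
end

section
/- Define q : ZZ^4 -> ZZ by q(r,m,n,s) = 4m^2 + 2mn - 2n^2 - 2rs and phi : ZZ^4 -> ZZ^2 by phi(r,m,n,s) = (4m + n + 2s, -r - 4m - n - s). Then for all integers a, b with gcd(a,b) = 1 and every w in ZZ^4 with phi(w) = (a,b), the strict inequality q(w) + 2 < a^2 + 2ab + 2b^2 + 1 holds. -/
/-- For coprime `(a,b)`, every lift `w` of `(a,b)` under `φ` satisfies
`q(w) + 2 < a² + 2ab + 2b² + 1`. -/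
theorem quartic_lift_strict_ineq (a b : ℤ) (hab : Int.gcd a b = 1)
    (w : ℤ × ℤ × ℤ × ℤ) (hw : quarticPhi w = (a, b)) :
    quarticQ w + 2 < a ^ 2 + 2 * a * b + 2 * b ^ 2 + 1 := by
  obtain ⟨r, m, n, s⟩ := w
  simp only [quarticPhi, Prod.mk.injEq] at hw
  obtain ⟨ha, hb⟩ := hw
  simp only [quarticQ]
  by_contra hcon
  have h1 : r ^ 2 + s ^ 2 + (r + s + (4 * m + n)) ^ 2 - 4 * m ^ 2 - 2 * m * n + 2 * n ^ 2 ≤ 1 := by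
    subst ha hb
    nlinarith
  have h2 : 4 * m ^ 2 + 2 * m * n + 7 * n ^ 2 ≤ 3 := by
    nlinarith [sq_nonneg (r - s), sq_nonneg (3 * (r + s) + 2 * (4 * m + n))]
  have hn2 : n ^ 2 < 1 := by nlinarith [sq_nonneg (m + n), sq_nonneg m]
  have hn : n = 0 := by
    by_contra h
    have := sq_pos_of_ne_zero h
    omega
  subst hn
  have hm2 : m ^ 2 < 1 := by nlinarith
  have hm : m = 0 := by
    by_contra h
    have := sq_pos_of_ne_zero h
    omega
  subst hm
  have h3 : r ^ 2 + s ^ 2 + r * s ≤ 0 := by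
    have : 2 * (r ^ 2 + s ^ 2 + r * s) ≤ 1 := by nlinarith
    omega
  have hr : r = 0 := by
    by_contra h
    have := sq_pos_of_ne_zero h
    nlinarith [sq_nonneg (r + 2 * s)]
  have hs : s = 0 := by
    by_contra h
    have := sq_pos_of_ne_zero h
    nlinarith [sq_nonneg (s + 2 * r)]
  subst hr hs
  norm_num at ha hb
  subst ha hb
  simp at hab
end

section
/- For an integer x, define q_{x,2} : ZZ^4 -> ZZ by q_{x,2}(r,m,n,s) = 10m^2 + 2x*mn + 2n^2 - 2rs and phi_x : ZZ^4 -> ZZ^2 by phi_x(r,m,n,s) = (-r + s, 2r + 10m + x*n + 2s). Let p, q be integers with either (p odd, q > 0 and gcd(p,q) = 1) or (p,q) = (1,0), and set x = q + 6. Then there exists w in ZZ^4 with phi_x(w) = (p,q) and q_{x,2}(w) >= -2. -/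
/-- The Mukai square `q_{x,2}(r,m,n,s) = 10m² + 2x·mn + 2n² - 2rs`. -/
def gmQ (x : ℤ) (w : ℤ × ℤ × ℤ × ℤ) : ℤ :=
  10 * w.2.1 ^ 2 + 2 * x * w.2.1 * w.2.2.1 + 2 * w.2.2.1 ^ 2 - 2 * w.1 * w.2.2.2

/-- The induced map `φ_x(r,m,n,s) = (-r + s, 2r + 10m + x·n + 2s)`. -/
def gmPhi (x : ℤ) (w : ℤ × ℤ × ℤ × ℤ) : ℤ × ℤ :=
  (-w.1 + w.2.2.2, 2 * w.1 + 10 * w.2.1 + x * w.2.2.1 + 2 * w.2.2.2)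

/-- Lemma 6.6 (lattice content, case `p` odd): for `p` odd, `q > 0`, `gcd(p,q)=1`,
or `(p,q) = (1,0)`, with `x = q + 6`, there exists `w` with `φ_x(w) = (p,q)`
and `q_{x,2}(w) ≥ -2`. -/
theorem gm_lift_p_odd (p q : ℤ)
    (hpq : (Odd p ∧ 0 < q ∧ Int.gcd p q = 1) ∨ (p = 1 ∧ q = 0)) :
    ∃ w : ℤ × ℤ × ℤ × ℤ, gmPhi (q + 6) w = (p, q) ∧ gmQ (q + 6) w ≥ -2 := by
  have hp : Odd p := by
    rcases hpq with h | h
    · exact h.1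
    · rw [h.1]; exact odd_one
  obtain ⟨j, rfl⟩ := hp
  refine ⟨(-(j + 2), 0, 1, j - 1), ?_, ?_⟩
  · simp only [gmPhi, Prod.mk.injEq]
    constructor <;> ring
  · simp only [gmQ]
    have h : 0 ≤ j * (j + 1) := by
      rcases le_or_gt 0 j with h | h
      · exact mul_nonneg h (by omega)
      · exact mul_nonneg_of_nonpos_of_nonpos (by omega) (by omega)
    nlinarith [h]
end

section
/- For an integer x, define q_{x,2}(r,m,n,s) = 10m^2 + 2x*mn + 2n^2 - 2rs and phi_x(r,m,n,s) = (-r + s, 2r + 10m + x*n + 2s) on ZZ^4. Let p, q be coprime integers with q > 0. (i) If p is odd, then every w in ZZ^4 with phi_{q+6}(w) = (p,q) satisfies q_{q+6,2}(w) + 2 < p^2 + q^2 + 1. (ii) If p is even and q != 1, then every w in ZZ^4 with phi_{q+4}(w) = (p,q) satisfies q_{q+4,2}(w) + 2 < p^2 + q^2 + 1. -/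
theorem gm_key (x p q r m n s : ℤ) (h1 : -r + s = p)
    (h2 : 2 * r + 10 * m + x * n + 2 * s = q) :
    40 * (p ^ 2 + q ^ 2 - 1 - (10 * m ^ 2 + 2 * x * m * n + 2 * n ^ 2 - 2 * r * s)) =
      20 * (p ^ 2 + q ^ 2) - 40 + 4 * n ^ 2 * (x ^ 2 - 20) + (10 * m + x * n - 5 * q) ^ 2 := by
  subst h1
  subst h2
  ring

/-- Remark after Theorem 1.2(1): for coprime `p, q` with `q > 0`, every lift
`w` of `(p,q)` under `φ_x` (with `x = q+6` if `p` is odd, `x = q+4` if `p` is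
even and `q ≠ 1`) satisfies `q_{x,2}(w) + 2 < p² + q² + 1`. -/
theorem gm_lift_strict_ineq (p q : ℤ) (hpq : Int.gcd p q = 1) (hq : 0 < q) :
    (Odd p → ∀ w : ℤ × ℤ × ℤ × ℤ, gmPhi (q + 6) w = (p, q) →
      gmQ (q + 6) w + 2 < p ^ 2 + q ^ 2 + 1) ∧
    (Even p → q ≠ 1 → ∀ w : ℤ × ℤ × ℤ × ℤ, gmPhi (q + 4) w = (p, q) →
      gmQ (q + 4) w + 2 < p ^ 2 + q ^ 2 + 1) := by
  constructor
  · rintro ⟨k, hk⟩ ⟨r, m, n, s⟩ hw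
    simp only [gmPhi, Prod.mk.injEq] at hw
    obtain ⟨h1, h2⟩ := hw
    have key := gm_key (q + 6) p q r m n s h1 h2
    simp only [gmQ]
    have hp : 1 ≤ p ^ 2 := by
      have : p ≠ 0 := by omega
      have := pow_pos (abs_pos.mpr this) 2
      rw [sq_abs] at this
      omega
    have hq2 : 1 ≤ q ^ 2 := by nlinarith
    have hx : 1 ≤ (q + 6) ^ 2 - 20 := by nlinarith
    have hsq := sq_nonneg (10 * m + (q + 6) * n - 5 * q)
    by_cases hn : n = 0
    · subst hn
      by_cases hq1 : q = 1
      · subst hq1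
        have : 0 < (10 * m + (1 + 6) * 0 - 5 * 1) ^ 2 := by
          have : 10 * m + (1 + 6) * 0 - 5 * 1 ≠ 0 := by omega
          positivity
        linarith
      · have : 4 ≤ q ^ 2 := by
          have : 2 ≤ q := by omega
          nlinarith
        linarith
    · have hn2 : 0 < n ^ 2 := by positivity
      have : 0 < 4 * n ^ 2 * ((q + 6) ^ 2 - 20) := by
        apply mul_pos <;> linarith
      linarith
  · rintro - hq1 ⟨r, m, n, s⟩ hw
    simp only [gmPhi, Prod.mk.injEq] at hw
    obtain ⟨h1, h2⟩ := hw
    have key := gm_key (q + 4) p q r m n s h1 h2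
    simp only [gmQ]
    have hq2 : 2 ≤ q := by omega
    have hq4 : 4 ≤ q ^ 2 := by nlinarith
    have hx : 0 ≤ (q + 4) ^ 2 - 20 := by nlinarith
    have hsq := sq_nonneg (10 * m + (q + 4) * n - 5 * q)
    have hp := sq_nonneg p
    have : 0 ≤ 4 * n ^ 2 * ((q + 4) ^ 2 - 20) := by
      apply mul_nonneg _ hx
      positivity
    linarith
end
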